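/- arXiv:2605.19904 — 2 statements merged into one kernel-verified Lean document; each statement's English description precedes it below -/
import Mathlib

section
/- For all integers n ≥ 0 and k ≥ 0 and every real number x with |x| < 1, the series ∑_{d=k+1}^{∞} d^n x^d converges and equals ∑_{i=0}^{n} e^k_{n,i} x^{k+i+1} / (1−x)^{n+1}. -/
/-- The extended Eulerian numbers `e^k_{n,i}`: `e^k_{0,0} = 1`, `e^k_{n,i} = 0` whenever
`i < 0` or `i > n`, and otherwise
`e^k_{n,i} = (k+i+1)·e^k_{n-1,i} + (n-k-i)·e^k_{n-1,i-1}`. -/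
def eulk (k : ℕ) : ℕ → ℕ → ℤ
  | 0, 0 => 1
  | 0, _ + 1 => 0
  | n + 1, 0 => ((k : ℤ) + 1) * eulk k n 0
  | n + 1, i + 1 =>
    if i + 1 > n + 1 then 0
    else ((k : ℤ) + (i + 1) + 1) * eulk k n (i + 1) + ((n : ℤ) - k - i) * eulk k n i

theorem eulk_eq_zero_of_lt (k : ℕ) {n i : ℕ} (h : n < i) : eulk k n i = 0 := by
  match n, i, h with
  | 0, i + 1, _ => simp [eulk]
  | n + 1, i + 1, h => simp [eulk, h]

/-- The numerator of the generating function of `d ↦ d ^ n` over `d > k`. -/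
noncomputable def eulkNumerator (k n : ℕ) (x : ℝ) : ℝ :=
  ∑ i ∈ Finset.range (n + 1), (eulk k n i : ℝ) * x ^ (k + i + 1)

theorem eulkNumerator_succ (k n : ℕ) (x : ℝ) :
    eulkNumerator k (n + 1) x = ∑ i ∈ Finset.range (n + 1), (eulk k n i : ℝ) *
      (((k + i + 1 : ℕ) : ℝ) * x ^ (k + i + 1) + ((n : ℝ) - k - i) * x ^ (k + i + 2)) := by
  have hstep : ∀ i ∈ Finset.range (n + 1), (eulk k (n + 1) (i + 1) : ℝ) * x ^ (k + (i + 1) + 1) =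
      (eulk k n (i + 1) : ℝ) * (((k + (i + 1) + 1 : ℕ) : ℝ) * x ^ (k + (i + 1) + 1)) +
        (eulk k n i : ℝ) * (((n : ℝ) - k - i) * x ^ (k + i + 2)) := by
    intro i hi
    have hi' : ¬ i + 1 > n + 1 := by
      have := Finset.mem_range.mp hi
      omega
    rw [eulk, if_neg hi']
    push_cast
    ring
  have hshift : ∑ i ∈ Finset.range (n + 1),
        (eulk k n (i + 1) : ℝ) * (((k + (i + 1) + 1 : ℕ) : ℝ) * x ^ (k + (i + 1) + 1)) +
      (eulk k n 0 : ℝ) * (((k + 0 + 1 : ℕ) : ℝ) * x ^ (k + 0 + 1)) =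
      ∑ i ∈ Finset.range (n + 1),
        (eulk k n i : ℝ) * (((k + i + 1 : ℕ) : ℝ) * x ^ (k + i + 1)) := by
    rw [← Finset.sum_range_succ'
      (fun i => (eulk k n i : ℝ) * (((k + i + 1 : ℕ) : ℝ) * x ^ (k + i + 1))),
      Finset.sum_range_succ, eulk_eq_zero_of_lt k (Nat.lt_succ_self n)]
    simp
  have hzero : (eulk k (n + 1) 0 : ℝ) * x ^ (k + 0 + 1) =
      (eulk k n 0 : ℝ) * (((k + 0 + 1 : ℕ) : ℝ) * x ^ (k + 0 + 1)) := by
    rw [eulk]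
    push_cast
    ring
  simp_rw [mul_add (eulk k n _ : ℝ)]
  rw [eulkNumerator, Finset.sum_range_succ', Finset.sum_congr rfl hstep, hzero,
    Finset.sum_add_distrib, Finset.sum_add_distrib, ← hshift]
  ring

theorem hasDerivAt_eulkNumerator (k n : ℕ) (x : ℝ) :
    HasDerivAt (eulkNumerator k n)
      (∑ i ∈ Finset.range (n + 1), (eulk k n i : ℝ) * (((k + i + 1 : ℕ) : ℝ) * x ^ (k + i))) x :=
  HasDerivAt.fun_sum fun i _ => (hasDerivAt_pow (k + i + 1) x).const_mul _

theorem summable_shifted_pow_mul_pow (n k : ℕ) {x : ℝ} (hx : |x| < 1) :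
    Summable (fun d : ℕ => ((d + k + 1 : ℕ) : ℝ) ^ n * x ^ (d + k + 1)) := by
  have h : Summable (fun d : ℕ => (d : ℝ) ^ n * x ^ d) :=
    summable_pow_mul_geometric_of_norm_lt_one n (by simpa using hx)
  exact h.comp_injective (i := fun d => d + k + 1) fun a b hab => by
    simpa using hab

theorem hasDerivAt_tsum_shifted_pow_mul_pow (n k : ℕ) {x : ℝ} (hx : |x| < 1) :
    HasDerivAt (fun y : ℝ => ∑' d : ℕ, ((d + k + 1 : ℕ) : ℝ) ^ n * y ^ (d + k + 1))
      (∑' d : ℕ, ((d + k + 1 : ℕ) : ℝ) ^ n * (((d + k + 1 : ℕ) : ℝ) * x ^ (d + k))) x := by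
  obtain ⟨r, hxr, hr1⟩ := exists_between hx
  have hr0 : 0 < r := (abs_nonneg x).trans_lt hxr
  have hu : Summable (fun d : ℕ => ((d + k + 1 : ℕ) : ℝ) ^ n *
      (((d + k + 1 : ℕ) : ℝ) * r ^ (d + k))) := by
    refine ((summable_shifted_pow_mul_pow (n + 1) k
      (x := r) (by rwa [abs_of_pos hr0])).mul_right r⁻¹).congr fun d => ?_
    field_simp
    ring
  have hmem : x ∈ Metric.ball (0 : ℝ) r := by simpa using hxr
  refine hasDerivAt_tsum_of_isPreconnected
    (g := fun d y => ((d + k + 1 : ℕ) : ℝ) ^ n * y ^ (d + k + 1))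
    (g' := fun d y => ((d + k + 1 : ℕ) : ℝ) ^ n * (((d + k + 1 : ℕ) : ℝ) * y ^ (d + k)))
    hu Metric.isOpen_ball (convex_ball (0 : ℝ) r).isPreconnected
    (fun d y _ => (hasDerivAt_pow (d + k + 1) y).const_mul _) (fun d y hy => ?_)
    hmem (summable_shifted_pow_mul_pow n k hx) hmem
  have hyr : |y| ≤ r := by
    have : |y| < r := by simpa using hy
    exact this.le
  simp only [norm_mul, norm_pow, Real.norm_eq_abs, Nat.abs_cast]
  gcongr

theorem tsum_shifted_pow_mul_pow (n k : ℕ) {x : ℝ} (hx : |x| < 1) :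
    ∑' d : ℕ, ((d + k + 1 : ℕ) : ℝ) ^ n * x ^ (d + k + 1) =
      eulkNumerator k n x / (1 - x) ^ (n + 1) := by
  induction n generalizing x with
  | zero =>
    simp only [pow_zero, one_mul, add_assoc, pow_add x _ (k + 1), tsum_mul_right]
    rw [tsum_geometric_of_abs_lt_one hx]
    simp [eulkNumerator, eulk, div_eq_inv_mul]
  | succ n ih =>
    have hx1 : 1 - x ≠ 0 := by
      have := (abs_lt.mp hx).2
      linarith
    have hquot := (hasDerivAt_eulkNumerator k n x).fun_div
      (((hasDerivAt_id' x).const_sub 1).fun_pow (n + 1)) (pow_ne_zero _ hx1)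
    have hopen : {y : ℝ | |y| < 1} ∈ nhds x :=
      (isOpen_lt continuous_abs continuous_const).mem_nhds hx
    have hseries := (hasDerivAt_tsum_shifted_pow_mul_pow n k hx).congr_of_eventuallyEq
      (Filter.mem_of_superset hopen fun y hy => (ih hy).symm)
    have hmul : ∑' d : ℕ, ((d + k + 1 : ℕ) : ℝ) ^ (n + 1) * x ^ (d + k + 1) =
        x * ∑' d : ℕ, ((d + k + 1 : ℕ) : ℝ) ^ n * (((d + k + 1 : ℕ) : ℝ) * x ^ (d + k)) := by
      rw [← tsum_mul_left]
      exact tsum_congr fun d => by ring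
    have hnum : eulkNumerator k (n + 1) x = x * (1 - x) * (∑ i ∈ Finset.range (n + 1),
        (eulk k n i : ℝ) * (((k + i + 1 : ℕ) : ℝ) * x ^ (k + i))) +
          (n + 1) * x * eulkNumerator k n x := by
      rw [eulkNumerator_succ, eulkNumerator, Finset.mul_sum, Finset.mul_sum,
        ← Finset.sum_add_distrib]
      refine Finset.sum_congr rfl fun i _ => ?_
      push_cast
      ring
    rw [hmul, hseries.unique hquot, hnum]
    simp only [Nat.add_sub_cancel]
    push_cast
    field_simp
    ring

/-- For integers `n, k ≥ 0` and `|x| < 1`, the series `∑_{d=k+1}^∞ d^n x^d` converges and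
equals `∑_{i=0}^n e^k_{n,i} x^{k+i+1} / (1-x)^{n+1}`. -/
theorem stmt_1 (n k : ℕ) (x : ℝ) (hx : |x| < 1) :
    Summable (fun d : ℕ => ((d + k + 1 : ℕ) : ℝ) ^ n * x ^ (d + k + 1)) ∧
      ∑' d : ℕ, ((d + k + 1 : ℕ) : ℝ) ^ n * x ^ (d + k + 1) =
        ∑ i ∈ Finset.range (n + 1), (eulk k n i : ℝ) * x ^ (k + i + 1) / (1 - x) ^ (n + 1) := by
  refine ⟨summable_shifted_pow_mul_pow n k hx, ?_⟩
  rw [tsum_shifted_pow_mul_pow n k hx, eulkNumerator, Finset.sum_div]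
end

section
/- Let k ≥ 1 and let S = H^k (a run of k heads). Then E(Y^2) = 2(1 − p^k) / ((1−p)^2 p^{2k}) − (2k + 1 − p^k) / ((1−p) p^k). -/
/-- The probability of a given sequence of coin flips, where `true` stands for heads
(probability `p`) and `false` for tails (probability `1 - p`). -/
def coinP (p : ℝ) (w : List Bool) : ℝ := (w.map fun b => if b then p else 1 - p).prod

/-- The number of occurrences of `S` as a factor (consecutive substring) of `w`. -/
def numOccs (S w : List Bool) : ℕ :=
  ((Finset.range (w.length + 1)).filter fun i => (w.drop i).take S.length = S).card

/-- `coinZ S` is the set of finite binary strings in which `S` occurs exactly once as a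
factor, namely as a suffix. -/
def coinZ (S : List Bool) : Set (List Bool) := {w | S <:+ w ∧ numOccs S w = 1}

/-- The `n`-th moment `E(Y^n) = ∑_{w ∈ Z(S)} |w|^n P(w)` of the number of coin flips
needed to produce `S`. -/
noncomputable def coinE (p : ℝ) (S : List Bool) (n : ℕ) : ℝ :=
  ∑' w : coinZ S, (w.1.length : ℝ) ^ n * coinP p w.1

/-! ### Sums over lists -/

/-- A list is either empty or a head together with a tail. -/
def listEquivOption (α : Type*) : List α ≃ Option (α × List α) where
  toFun
    | [] => none
    | a :: l => some (a, l)
  invFun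
    | none => []
    | some (a, l) => a :: l
  left_inv l := by cases l <;> rfl
  right_inv o := by rcases o with _ | ⟨a, l⟩ <;> rfl

theorem tsum_list_eq {α : Type*} [Fintype α] {g : List α → ℝ} (hg : Summable g) :
    ∑' l, g l = g [] + ∑ a, ∑' l, g (a :: l) := by
  have h1 : Summable (g ∘ (listEquivOption α).symm) := (Equiv.summable_iff _).2 hg
  have h2 : Summable fun x : α × List α => g (x.1 :: x.2) :=
    h1.comp_injective (Option.some_injective _)
  rw [← (listEquivOption α).symm.tsum_eq g]
  have h3 : HasSum (g ∘ (listEquivOption α).symm)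
      (g [] + ∑' x : α × List α, g (x.1 :: x.2)) := by
    have hsome := (Option.some_injective (α × List α)).hasSum_range_iff
      (f := g ∘ (listEquivOption α).symm) |>.2 h2.hasSum
    exact (hasSum_singleton none _).add_isCompl (Set.isCompl_range_some_none _).symm hsome
  refine h3.tsum_eq.trans ?_
  rw [h2.tsum_prod, tsum_fintype]

/-- The lists of length at most `N`. -/
noncomputable def listsUpTo (α : Type*) [Fintype α] [DecidableEq α] : ℕ → Finset (List α)
  | 0 => {[]}
  | N + 1 => insert [] ((Finset.univ ×ˢ listsUpTo α N).image fun x : α × List α => x.1 :: x.2)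

theorem mem_listsUpTo {α : Type*} [Fintype α] [DecidableEq α] {N : ℕ} {l : List α}
    (hl : l.length ≤ N) : l ∈ listsUpTo α N := by
  induction N generalizing l with
  | zero => simp_all [listsUpTo]
  | succ N ih =>
    cases l with
    | nil => simp [listsUpTo]
    | cons a l =>
      simp only [List.length_cons, add_le_add_iff_right] at hl
      simp [listsUpTo, ih hl]

theorem sum_listsUpTo_succ {α : Type*} [Fintype α] [DecidableEq α] (g : List α → ℝ) (N : ℕ) :
    ∑ l ∈ listsUpTo α (N + 1), g l = g [] + ∑ a, ∑ l ∈ listsUpTo α N, g (a :: l) := by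
  rw [listsUpTo, Finset.sum_insert (by simp), Finset.sum_image, Finset.sum_product]
  rintro ⟨a, l⟩ _ ⟨b, m⟩ _ h
  simpa using h

/-- A nonnegative function on lists is summable if prepending a letter contracts it on average, up
to a summable error. -/
theorem summable_list_of_le {α : Type*} [Fintype α] {g h : List α → ℝ} {a b : α → ℝ}
    (hg : ∀ l, 0 ≤ g l) (hh : ∀ l, 0 ≤ h l) (hb : ∀ x, 0 ≤ b x) (ha : ∀ x, 0 ≤ a x)
    (ha1 : ∑ x, a x < 1) (hs : Summable h)
    (hle : ∀ x l, g (x :: l) ≤ a x * g l + b x * h l) : Summable g := by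
  classical
  have hH : 0 ≤ ∑' l, h l := tsum_nonneg hh
  have hB : 0 ≤ ∑ x, b x := Finset.sum_nonneg fun x _ => hb x
  have hA : 0 ≤ ∑ x, a x := Finset.sum_nonneg fun x _ => ha x
  obtain ⟨C, hC⟩ : ∃ C, C = (g [] + (∑ x, b x) * ∑' l, h l) / (1 - ∑ x, a x) := ⟨_, rfl⟩
  have hC' : g [] + ((∑ x, a x) * C + (∑ x, b x) * ∑' l, h l) = C := by
    have : (1 - ∑ x, a x) ≠ 0 := by linarith
    rw [eq_div_iff this] at hC
    linarith
  have hC0 : 0 ≤ C := by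
    rw [hC]
    exact div_nonneg (add_nonneg (hg _) (mul_nonneg hB hH)) (by linarith)
  have key : ∀ N, ∑ l ∈ listsUpTo α N, g l ≤ C := by
    intro N
    induction N with
    | zero =>
      simp only [listsUpTo, Finset.sum_singleton]
      nlinarith [mul_nonneg hA hC0, mul_nonneg hB hH]
    | succ N ih =>
      rw [sum_listsUpTo_succ, ← hC', Finset.sum_mul, Finset.sum_mul, ← Finset.sum_add_distrib]
      gcongr with x
      calc ∑ l ∈ listsUpTo α N, g (x :: l)
          ≤ ∑ l ∈ listsUpTo α N, (a x * g l + b x * h l) := Finset.sum_le_sum fun l _ => hle x l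
        _ = a x * ∑ l ∈ listsUpTo α N, g l + b x * ∑ l ∈ listsUpTo α N, h l := by
          rw [Finset.sum_add_distrib, Finset.mul_sum, Finset.mul_sum]
        _ ≤ a x * C + b x * ∑' l, h l :=
          add_le_add (mul_le_mul_of_nonneg_left ih (ha x))
            (mul_le_mul_of_nonneg_left (hs.sum_le_tsum _ fun l _ => hh l) (hb x))
  refine summable_of_sum_le (c := C) hg fun s => ?_
  refine (Finset.sum_le_sum_of_subset_of_nonneg (fun l hl => mem_listsUpTo ?_)
    fun l _ _ => hg l).trans (key (s.sup List.length))
  exact Finset.le_sup (f := List.length) hl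

/-! ### Occurrences of a run of heads -/

theorem numOccs_cons (S : List Bool) (a : Bool) (w : List Bool) :
    numOccs S (a :: w) = (if (a :: w).take S.length = S then 1 else 0) + numOccs S w := by
  simp only [numOccs, List.length_cons, Finset.card_filter]
  rw [Finset.sum_range_succ', add_comm]
  simp

theorem numOccs_eq_zero_of_length_lt {S w : List Bool} (h : w.length < S.length) :
    numOccs S w = 0 := by
  simp only [numOccs, Finset.card_eq_zero, Finset.filter_eq_empty_iff]
  intro i _ he
  have := congrArg List.length he
  simp at this
  omega

theorem numOccs_self {S : List Bool} (hS : S ≠ []) : numOccs S S = 1 := by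
  cases S with
  | nil => exact absurd rfl hS
  | cons a S =>
    rw [numOccs_cons, numOccs_eq_zero_of_length_lt (by simp)]
    simp

theorem numOccs_pos_of_suffix {S w : List Bool} (h : S <:+ w) : 0 < numOccs S w := by
  obtain ⟨t, rfl⟩ := h
  refine Finset.card_pos.2 ⟨t.length, ?_⟩
  simp

theorem replicate_not_prefix_append {k j : ℕ} (hj : j < k) (w : List Bool) :
    ¬ List.replicate k true <+: List.replicate j true ++ false :: w := by
  intro h
  have h1 := h.getElem (i := j) (by simpa using hj)
  simp at h1

theorem numOccs_replicate_append {k j : ℕ} (hj : j < k) (w : List Bool) :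
    numOccs (List.replicate k true) (List.replicate j true ++ false :: w) =
      numOccs (List.replicate k true) w := by
  have key : ∀ j < k, (List.replicate j true ++ false :: w).take (List.replicate k true).length ≠
      List.replicate k true := fun j hj h =>
    replicate_not_prefix_append hj w (List.prefix_iff_eq_take.2 h.symm)
  induction j with
  | zero =>
    have := key 0 hj
    simp only [List.replicate_zero, List.nil_append] at this ⊢
    rw [numOccs_cons, if_neg this, zero_add]
  | succ j ih =>
    have := key (j + 1) hj
    simp only [List.replicate_succ, List.cons_append] at this ⊢
    rw [numOccs_cons, if_neg this, zero_add, ih (by omega)]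

theorem replicate_suffix_append_iff {k : ℕ} (j : ℕ) (w : List Bool) :
    List.replicate k true <:+ List.replicate j true ++ false :: w ↔
      List.replicate k true <:+ w := by
  have hmem : false ∉ List.replicate k true := by simp
  constructor
  · intro h
    rcases List.suffix_or_suffix_of_suffix h (List.suffix_append _ (false :: w)) with h1 | h1
    · rcases List.suffix_cons_iff.1 h1 with h2 | h2
      · rw [h2] at hmem
        simp at hmem
      · exact h2
    · exact absurd (h1.subset (by simp)) hmem
  · intro h
    exact (h.trans (List.suffix_cons _ _)).trans (List.suffix_append _ _)

theorem mem_coinZ_replicate_append_iff {k j : ℕ} (hj : j < k) (w : List Bool) :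
    List.replicate j true ++ false :: w ∈ coinZ (List.replicate k true) ↔
      w ∈ coinZ (List.replicate k true) := by
  simp only [coinZ, Set.mem_ofPred_eq, numOccs_replicate_append hj,
    replicate_suffix_append_iff j]

theorem replicate_prefix_or (k : ℕ) (w : List Bool) :
    List.replicate k true <+: w ∨
      (∃ j < k, ∃ w', w = List.replicate j true ++ false :: w') ∨ w.length < k := by
  induction k generalizing w with
  | zero => simp
  | succ k ih =>
    rcases w with _ | ⟨_ | _, w⟩
    · simp
    · exact Or.inr (Or.inl ⟨0, by simp, w, rfl⟩)
    · rcases ih w with h | ⟨j, hj, w', rfl⟩ | h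
      · left
        simpa [List.replicate_succ, List.cons_prefix_cons] using h
      · exact Or.inr (Or.inl ⟨j + 1, by omega, w', rfl⟩)
      · exact Or.inr (Or.inr (by simpa using h))

theorem eq_of_prefix_of_mem_coinZ {S w : List Bool} (hw : w ∈ coinZ S) (h : S <+: w) :
    w = S := by
  obtain ⟨hsuf, hocc⟩ := hw
  cases w with
  | nil => exact (List.prefix_nil.1 h).symm
  | cons a w =>
    rcases List.suffix_cons_iff.1 hsuf with h1 | h1
    · exact h1.symm
    · have := numOccs_pos_of_suffix h1
      rw [numOccs_cons, if_pos (List.prefix_iff_eq_take.1 h).symm] at hocc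
      omega

/-- The word consisting of the runs of heads of lengths given by the list, each followed by a
tail, and of a final run of `k` heads. -/
def runWord (k : ℕ) : List (Fin k) → List Bool
  | [] => List.replicate k true
  | j :: l => List.replicate j true ++ false :: runWord k l

theorem replicate_append_false_inj {i j : ℕ} {v w : List Bool}
    (h : List.replicate i true ++ false :: v = List.replicate j true ++ false :: w) :
    i = j ∧ v = w := by
  induction i generalizing j with
  | zero => cases j <;> simp_all [List.replicate_succ]
  | succ i ih =>
    cases j with
    | zero => simp [List.replicate_succ] at h
    | succ j =>
      simp only [List.replicate_succ, List.cons_append, List.cons.injEq, true_and] at h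
      simpa using ih h

theorem runWord_injective (k : ℕ) : Function.Injective (runWord k) := by
  have hne : ∀ (j : ℕ) (w : List Bool),
      List.replicate k true ≠ List.replicate j true ++ false :: w := by
    intro j w h
    have : false ∉ List.replicate k true := by simp
    rw [h] at this
    simp at this
  intro l
  induction l with
  | nil =>
    rintro (_ | ⟨j, m⟩) h
    · rfl
    · exact absurd h (hne _ _)
  | cons i l ih =>
    rintro (_ | ⟨j, m⟩) h
    · exact absurd h.symm (hne _ _)
    · obtain ⟨h1, h2⟩ := replicate_append_false_inj h
      rw [Fin.ext h1, ih h2]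

theorem range_runWord {k : ℕ} (hk : 1 ≤ k) :
    Set.range (runWord k) = coinZ (List.replicate k true) := by
  apply Set.Subset.antisymm
  · rintro _ ⟨l, rfl⟩
    induction l with
    | nil =>
      refine ⟨List.suffix_refl _, numOccs_self fun h => ?_⟩
      rw [List.replicate_eq_nil_iff] at h
      omega
    | cons j l ih => exact (mem_coinZ_replicate_append_iff j.2 _).2 ih
  · intro w hw
    induction hn : w.length using Nat.strong_induction_on generalizing w with
    | _ n ih =>
      rcases replicate_prefix_or k w with h | ⟨j, hj, w', rfl⟩ | h
      · exact ⟨[], (eq_of_prefix_of_mem_coinZ hw h).symm⟩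
      · obtain ⟨l, rfl⟩ := ih w'.length (by simp at hn; omega)
          ((mem_coinZ_replicate_append_iff hj w').1 hw) rfl
        exact ⟨⟨j, hj⟩ :: l, rfl⟩
      · have := hw.1.length_le
        simp at this
        omega

theorem coinE_replicate {k : ℕ} (hk : 1 ≤ k) (p : ℝ) (n : ℕ) :
    coinE p (List.replicate k true) n =
      ∑' l, ((runWord k l).length : ℝ) ^ n * coinP p (runWord k l) := by
  rw [coinE, ← range_runWord hk]
  exact tsum_range (fun w : List Bool => (w.length : ℝ) ^ n * coinP p w) (runWord_injective k)

/-! ### Weights and lengths -/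

theorem coinP_runWord_nil (p : ℝ) (k : ℕ) : coinP p (runWord k []) = p ^ k := by
  simp [coinP, runWord]

theorem coinP_runWord_cons (p : ℝ) {k : ℕ} (j : Fin k) (l : List (Fin k)) :
    coinP p (runWord k (j :: l)) = p ^ (j : ℕ) * (1 - p) * coinP p (runWord k l) := by
  simp [coinP, runWord, mul_assoc]

theorem length_runWord_cons {k : ℕ} (j : Fin k) (l : List (Fin k)) :
    ((runWord k (j :: l)).length : ℝ) = ((j : ℕ) + 1 : ℝ) + (runWord k l).length := by
  simp only [runWord, List.length_append, List.length_replicate, List.length_cons]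
  push_cast
  ring

theorem coinP_nonneg {p : ℝ} (hp : 0 ≤ p) (hp1 : p ≤ 1) (w : List Bool) : 0 ≤ coinP p w := by
  refine List.prod_nonneg fun x hx => ?_
  obtain ⟨b, _, rfl⟩ := List.mem_map.1 hx
  split_ifs <;> linarith

theorem sum_run_weight (p : ℝ) (k : ℕ) :
    ∑ j : Fin k, p ^ (j : ℕ) * (1 - p) = 1 - p ^ k := by
  rw [← Finset.sum_mul, Fin.sum_univ_eq_sum_range (fun i => p ^ i) k, geom_sum_mul_neg]

theorem sum_run_weight_mul (p : ℝ) (k : ℕ) :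
    (1 - p) * ∑ j : Fin k, p ^ (j : ℕ) * (1 - p) * ((j : ℕ) + 1 : ℝ) =
      1 - (k + 1) * p ^ k + k * p ^ (k + 1) := by
  rw [Fin.sum_univ_eq_sum_range (fun i => p ^ i * (1 - p) * ((i : ℝ) + 1)) k]
  induction k with
  | zero => simp
  | succ k ih =>
    rw [Finset.sum_range_succ, mul_add, ih]
    push_cast
    ring

theorem sum_run_weight_mul_sq (p : ℝ) (k : ℕ) :
    (1 - p) ^ 2 * ∑ j : Fin k, p ^ (j : ℕ) * (1 - p) * ((j : ℕ) + 1 : ℝ) ^ 2 =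
      1 + p - p ^ k * ((k + 1) ^ 2 - (2 * k ^ 2 + 2 * k - 1) * p + k ^ 2 * p ^ 2) := by
  rw [Fin.sum_univ_eq_sum_range (fun i => p ^ i * (1 - p) * ((i : ℝ) + 1) ^ 2) k]
  induction k with
  | zero => simp
  | succ k ih =>
    rw [Finset.sum_range_succ, mul_add, ih]
    push_cast
    ring

theorem second_moment_eq_of_recurrence {p x k s t E0 E1 E2 : ℝ} (hp1 : p < 1) (hx : 0 < x)
    (s1 : (1 - p) * s = 1 - (k + 1) * x + k * (x * p))
    (s2 : (1 - p) ^ 2 * t =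
      1 + p - x * ((k + 1) ^ 2 - (2 * k ^ 2 + 2 * k - 1) * p + k ^ 2 * p ^ 2))
    (e0 : E0 = x + (1 - x) * E0) (e1 : E1 = k * x + s * E0 + (1 - x) * E1)
    (e2 : E2 = k ^ 2 * x + (t * E0 + s * (2 * E1) + (1 - x) * E2)) :
    E2 = 2 * (1 - x) / ((1 - p) ^ 2 * x ^ 2) - (2 * k + 1 - x) / ((1 - p) * x) := by
  have hq : 0 < 1 - p := by linarith
  have hE0 : E0 = 1 := mul_left_cancel₀ hx.ne' (by linarith)
  subst hE0
  have hs : s = (1 - (k + 1) * x + k * (x * p)) / (1 - p) := by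
    rw [eq_div_iff hq.ne']
    linarith
  have ht : t = (1 + p - x * ((k + 1) ^ 2 - (2 * k ^ 2 + 2 * k - 1) * p + k ^ 2 * p ^ 2)) /
      (1 - p) ^ 2 := by
    rw [eq_div_iff (by positivity)]
    linarith
  have hE1 : E1 = (k * x + s) / x := by
    rw [eq_div_iff hx.ne']
    linarith
  have hE2 : E2 = (k ^ 2 * x + t + s * (2 * E1)) / x := by
    rw [eq_div_iff hx.ne']
    linarith
  rw [hE2, hE1, hs, ht]
  field_simp
  ring

/-- Recurrences for the first moments of an additive length `L` under a multiplicative weight `P` on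
lists. -/
theorem tsum_moments_list {α : Type*} [Fintype α] {P L : List α → ℝ} {a c : α → ℝ}
    (hP0 : ∀ l, 0 ≤ P l) (hL0 : ∀ l, 0 ≤ L l) (ha0 : ∀ j, 0 ≤ a j) (hc0 : ∀ j, 0 ≤ c j)
    (hPc : ∀ j l, P (j :: l) = a j * P l) (hLc : ∀ j l, L (j :: l) = c j + L l)
    (hlt : ∑ j, a j < 1) :
    (∑' l, P l = P [] + (∑ j, a j) * ∑' l, P l) ∧
    (∑' l, L l * P l =
      L [] * P [] + (∑ j, a j * c j) * ∑' l, P l + (∑ j, a j) * ∑' l, L l * P l) ∧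
    ∑' l, L l ^ 2 * P l =
      L [] ^ 2 * P [] + ((∑ j, a j * c j ^ 2) * ∑' l, P l +
        (∑ j, a j * c j) * (2 * ∑' l, L l * P l) + (∑ j, a j) * ∑' l, L l ^ 2 * P l) := by
  have hs0 : Summable P :=
    summable_list_of_le (h := 0) (b := 0) hP0 (fun _ => le_rfl) (fun _ => le_rfl) ha0 hlt
      summable_zero fun j l => by simp [hPc]
  have hs1 : Summable fun l => L l * P l :=
    summable_list_of_le (b := fun j => a j * c j) (fun l => mul_nonneg (hL0 l) (hP0 l)) hP0
      (fun j => mul_nonneg (ha0 j) (hc0 j)) ha0 hlt hs0 fun j l => by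
        rw [hPc, hLc]
        exact le_of_eq (by ring)
  have hs2 : Summable fun l => L l ^ 2 * P l :=
    summable_list_of_le (h := fun l => 2 * (L l * P l) + (∑ i, c i) * P l)
      (b := fun j => a j * c j)
      (fun l => mul_nonneg (pow_nonneg (hL0 l) 2) (hP0 l))
      (fun l => add_nonneg (mul_nonneg zero_le_two (mul_nonneg (hL0 l) (hP0 l)))
        (mul_nonneg (Finset.sum_nonneg fun i _ => hc0 i) (hP0 l)))
      (fun j => mul_nonneg (ha0 j) (hc0 j)) ha0 hlt
      ((hs1.mul_left 2).add (hs0.mul_left _)) fun j l => by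
        rw [hPc, hLc]
        have h1 : c j ≤ ∑ i, c i :=
          Finset.single_le_sum (fun i _ => hc0 i) (Finset.mem_univ j)
        have h2 := mul_le_mul_of_nonneg_left h1
          (mul_nonneg (mul_nonneg (ha0 j) (hc0 j)) (hP0 l))
        linarith
  have e0 : ∑' l, P l = P [] + (∑ j, a j) * ∑' l, P l := by
    conv_lhs => rw [tsum_list_eq hs0]
    simp only [hPc, tsum_mul_left, Finset.sum_mul]
  have e1 : ∑' l, L l * P l =
      L [] * P [] + (∑ j, a j * c j) * ∑' l, P l + (∑ j, a j) * ∑' l, L l * P l := by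
    conv_lhs => rw [tsum_list_eq hs1]
    rw [Finset.sum_mul, Finset.sum_mul, add_assoc, ← Finset.sum_add_distrib]
    congr 1
    refine Finset.sum_congr rfl fun j _ => ?_
    rw [← tsum_mul_left, ← tsum_mul_left, ← (hs0.mul_left _).tsum_add (hs1.mul_left _)]
    refine tsum_congr fun l => ?_
    rw [hPc, hLc]
    ring
  have e2 : ∑' l, L l ^ 2 * P l =
      L [] ^ 2 * P [] + ((∑ j, a j * c j ^ 2) * ∑' l, P l +
        (∑ j, a j * c j) * (2 * ∑' l, L l * P l) + (∑ j, a j) * ∑' l, L l ^ 2 * P l) := by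
    conv_lhs => rw [tsum_list_eq hs2]
    rw [Finset.sum_mul, Finset.sum_mul, Finset.sum_mul, ← Finset.sum_add_distrib,
      ← Finset.sum_add_distrib]
    congr 1
    refine Finset.sum_congr rfl fun j _ => ?_
    rw [← tsum_mul_left, ← tsum_mul_left, ← tsum_mul_left, ← tsum_mul_left,
      ← (hs0.mul_left _).tsum_add ((hs1.mul_left _).mul_left _),
      ← ((hs0.mul_left _).add ((hs1.mul_left _).mul_left _)).tsum_add (hs2.mul_left _)]
    refine tsum_congr fun l => ?_
    rw [hPc, hLc]
    ring
  exact ⟨e0, e1, e2⟩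

/-- For `S = H^k`, `E(Y^2) = 2(1-p^k)/((1-p)^2 p^{2k}) - (2k+1-p^k)/((1-p) p^k)`. -/
theorem stmt_7 (p : ℝ) (hp : 0 < p) (hp1 : p < 1) (k : ℕ) (hk : 1 ≤ k) :
    coinE p (List.replicate k true) 2 =
      2 * (1 - p ^ k) / ((1 - p) ^ 2 * p ^ (2 * k)) -
        (2 * (k : ℝ) + 1 - p ^ k) / ((1 - p) * p ^ k) := by
  have hq : 0 < 1 - p := by linarith
  have hpk : 0 < p ^ k := pow_pos hp k
  rw [coinE_replicate hk]
  obtain ⟨e0, e1, e2⟩ := tsum_moments_list (P := fun l => coinP p (runWord k l))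
    (L := fun l => ((runWord k l).length : ℝ)) (a := fun j => p ^ (j : ℕ) * (1 - p))
    (c := fun j => ((j : ℕ) + 1 : ℝ)) (fun l => coinP_nonneg hp.le hp1.le _)
    (fun l => Nat.cast_nonneg _) (fun j => by positivity) (fun j => by positivity)
    (coinP_runWord_cons p) length_runWord_cons (by rw [sum_run_weight]; linarith)
  have hlen : ((runWord k []).length : ℝ) = k := by simp [runWord]
  simp only [sum_run_weight, coinP_runWord_nil, hlen] at e0 e1 e2
  have s1 := sum_run_weight_mul p k
  rw [pow_succ] at s1
  rw [mul_comm 2 k, pow_mul]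
  exact second_moment_eq_of_recurrence hp1 hpk s1 (sum_run_weight_mul_sq p k) e0 e1 e2
end
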